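/- Let (X, 𝓕, μ) be a σ-finite measure space, Φ an N-function satisfying the Δ₂-condition globally, and φ : X → X an injective nonsingular measurable map that maps measurable sets to measurable sets and satisfies μ(φ⁻¹(F)) ≤ c μ(F) for every F ∈ 𝓕 and some c > 0. Suppose there exists a measurable set F with 0 < μ(F) < ∞ such that, setting I = {n ∈ ℤ : 0 < μ(φ^n(F)) < ∞} (where φ^n(F) denotes the n-fold forward image for n ≥ 0 and the n-fold preimage for n < 0): (i) limsup_{n→∞} Φ⁻¹(1/μ(φ^{-n}(F))) = ∞, and (ii) sup{ Φ⁻¹(1/μ(φ^m(F))) / Φ⁻¹(1/μ(φ^n(F))) : n, m ∈ I, n < m } = ∞. Then the composition operator C_φ on L^Φ(μ) is Li-Yorke chaotic. -/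

import Mathlib

open MeasureTheory Filter Topology Set
open scoped ENNReal NNReal

noncomputable section

/-- A Young function: an even convex function `Φ : ℝ → [0,∞]` with `Φ 0 = 0` and
`Φ x → ∞` as `x → ∞`. -/
structure IsYoungFunction (Φ : ℝ → ℝ≥0∞) : Prop where
  even : ∀ x : ℝ, Φ (-x) = Φ x
  convex : ∀ x y : ℝ, ∀ a b : ℝ≥0, a + b = 1 →
    Φ ((a : ℝ) * x + (b : ℝ) * y) ≤ (a : ℝ≥0∞) * Φ x + (b : ℝ≥0∞) * Φ y
  map_zero : Φ 0 = 0
  tendsto_atTop : Tendsto Φ atTop (nhds ⊤)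

/-- An N-function: a finite-valued Young function vanishing exactly at `0`, with
`Φ x / x → 0` as `x → 0⁺` and `Φ x / x → ∞` as `x → ∞`. -/
structure IsNFunction (Φ : ℝ → ℝ≥0∞) extends IsYoungFunction Φ : Prop where
  lt_top : ∀ x : ℝ, Φ x < ⊤
  eq_zero_iff : ∀ x : ℝ, Φ x = 0 ↔ x = 0
  tendsto_div_zero : Tendsto (fun x : ℝ => Φ x / ENNReal.ofReal x) (nhdsWithin 0 (Set.Ioi 0)) (nhds 0)
  tendsto_div_atTop : Tendsto (fun x : ℝ => Φ x / ENNReal.ofReal x) atTop (nhds ⊤)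

/-- The Δ₂-condition, globally: `Φ (2 x) ≤ K Φ x` for all `x ≥ 0`, for some `K > 0`. -/
def Delta2Global (Φ : ℝ → ℝ≥0∞) : Prop :=
  ∃ K : ℝ≥0, 0 < K ∧ ∀ x : ℝ, 0 ≤ x → Φ (2 * x) ≤ (K : ℝ≥0∞) * Φ x

/-- The generalized inverse `Φ⁻¹ (y) = inf {x ≥ 0 : Φ x > y}` (with `inf ∅ = ∞`). -/
def youngInv (Φ : ℝ → ℝ≥0∞) (y : ℝ≥0∞) : ℝ≥0∞ :=
  ⨅ (x : ℝ) (_ : 0 ≤ x) (_ : y < Φ x), ENNReal.ofReal x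

/-- The Luxemburg (gauge) norm `N_Φ (f) = inf {k > 0 : ∫ Φ (f / k) dμ ≤ 1}`
(with `inf ∅ = ∞`). -/
def luxNorm {X : Type*} [MeasurableSpace X] (Φ : ℝ → ℝ≥0∞) (μ : Measure X)
    (f : X → ℝ) : ℝ≥0∞ :=
  ⨅ (k : ℝ) (_ : 0 < k) (_ : ∫⁻ x, Φ (f x / k) ∂μ ≤ 1), ENNReal.ofReal k

/-- Membership in the Orlicz space `L^Φ(μ)`: `f` is measurable and
`∫ Φ (k f) dμ < ∞` for some `k > 0`. -/
def MemOrlicz {X : Type*} [MeasurableSpace X] (Φ : ℝ → ℝ≥0∞) (μ : Measure X)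
    (f : X → ℝ) : Prop :=
  Measurable f ∧ ∃ k : ℝ, 0 < k ∧ ∫⁻ x, Φ (k * f x) ∂μ < ⊤

/-- Li-Yorke chaos for the composition operator `C_φ f = f ∘ φ` on `L^Φ(μ)`:
there is an uncountable set `S ⊆ L^Φ(μ)` of pairwise not μ-a.e. equal functions such
that every pair of not μ-a.e. equal members is a Li-Yorke pair for `C_φ`. -/
def CompLiYorkeChaotic {X : Type*} [MeasurableSpace X] (Φ : ℝ → ℝ≥0∞) (μ : Measure X)
    (φ : X → X) : Prop :=
  ∃ S : Set (X → ℝ), ¬ S.Countable ∧ (∀ f ∈ S, MemOrlicz Φ μ f) ∧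
    (∀ f ∈ S, ∀ g ∈ S, f ≠ g → ¬ f =ᵐ[μ] g) ∧
    ∀ f ∈ S, ∀ g ∈ S, ¬ f =ᵐ[μ] g →
      atTop.liminf (fun n : ℕ => luxNorm Φ μ ((f - g) ∘ φ^[n])) = 0 ∧
      0 < atTop.limsup (fun n : ℕ => luxNorm Φ μ ((f - g) ∘ φ^[n]))

/-- For `n : ℤ`, the set `φ^n(F)`: the `n`-fold forward image of `F` when `n ≥ 0`, and the
`|n|`-fold preimage of `F` when `n < 0`. -/
def iterImage {X : Type*} (φ : X → X) (F : Set X) (n : ℤ) : Set X :=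
  if 0 ≤ n then φ^[n.toNat] '' F else φ^[(-n).toNat] ⁻¹' F

/-- The candidates `v i`, each dominated by a shift of `w`, can be superposed into a sequence whose
sum is small at infinitely many times although some term is at least `2` at infinitely many
times. -/
theorem exists_seq_small_sum_of_unbounded_growth {ι : Type*} (v : ι → ℕ → ℝ≥0∞) (w : ℕ → ℝ≥0∞)
    (C : ℝ≥0) (hC : 1 ≤ C)
    (hv : ∀ i q, v i q ≤ (C : ℝ≥0∞) ^ q * v i 0)
    (hw : ∀ η : ℝ≥0∞, 0 < η → ∃ᶠ n in atTop, w n ≤ η)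
    (hwC : ∀ n q, w (n + q) ≤ (C : ℝ≥0∞) ^ q * w n)
    (hvw : ∀ i, ∃ J : ℕ, ∃ D : ℝ≥0, ∀ q, v i (q + J) ≤ D * w q)
    (hbig : ∀ ε : ℝ≥0∞, 0 < ε → ∃ i p, v i 0 ≤ ε ∧ 2 ≤ v i p) :
    ∃ u : ℕ → ι, ∑' k, v (u k) 0 ≤ 1 ∧
      (∀ (N : ℕ) (η : ℝ≥0∞), 0 < η → ∃ q ≥ N, ∑' k, v (u k) q ≤ η) ∧
      ∀ N : ℕ, ∃ p ≥ N, ∃ k, 2 ≤ v (u k) p := by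
  have hC' : (1 : ℝ≥0∞) ≤ C := by exact_mod_cast hC
  have hCtop : ∀ q : ℕ, (C : ℝ≥0∞) ^ q ≠ ⊤ := fun q => ENNReal.pow_ne_top ENNReal.coe_ne_top
  have hhalf : ∀ k : ℕ, (0 : ℝ≥0∞) < 2⁻¹ ^ k := fun k => by
    have : (2⁻¹ : ℝ≥0∞) ≠ 0 := by simp
    exact pos_iff_ne_zero.2 (pow_ne_zero _ this)
  let good : (ℕ → ℝ≥0∞) → Prop := fun s => ∃ J : ℕ, ∃ D : ℝ≥0, ∀ q, s (q + J) ≤ D * w q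
  have hgood : ∀ s i, good s → good (s + v i) := by
    rintro s i ⟨J, D, h⟩
    obtain ⟨J', D', h'⟩ := hvw i
    refine ⟨J + J', D * C ^ J' + D' * C ^ J, fun q => ?_⟩
    calc s (q + (J + J')) + v i (q + (J + J'))
        = s ((q + J') + J) + v i ((q + J) + J') := by
          rw [show q + (J + J') = q + J' + J by ring, show q + J + J' = q + J' + J by ring]
      _ ≤ D * (C ^ J' * w q) + D' * (C ^ J * w q) := by
          gcongr
          · exact (h _).trans (by gcongr; exact hwC _ _)
          · exact (h' _).trans (by gcongr; exact hwC _ _)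
      _ = _ := by push_cast; ring
  obtain ⟨i₀, -⟩ := hbig 1 one_pos
  have step : ∀ (k : ℕ) (σ : {σ : ι × (ℕ → ℝ≥0∞) × ℕ // good σ.2.1}),
      ∃ τ : {σ : ι × (ℕ → ℝ≥0∞) × ℕ // good σ.2.1},
        τ.1.2.1 = σ.1.2.1 + v τ.1.1 ∧ σ.1.2.2 < τ.1.2.2 ∧
        τ.1.2.1 τ.1.2.2 ≤ 2⁻¹ ^ (k + 1) ∧
        v τ.1.1 0 ≤ 2⁻¹ ^ (k + 1) / C ^ σ.1.2.2 ∧ ∃ p, 2 ≤ v τ.1.1 p := by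
    rintro k ⟨⟨i', s, q⟩, hs⟩
    obtain ⟨i, p, hi0, hip⟩ := hbig (2⁻¹ ^ (k + 1) / C ^ q)
      (ENNReal.div_pos (hhalf _).ne' (hCtop _))
    obtain ⟨J, D, hJ⟩ := hgood s i hs
    obtain ⟨n, hn, hwn⟩ := (frequently_atTop.1 (hw (2⁻¹ ^ (k + 1) / (D + 1))
      (ENNReal.div_pos (hhalf _).ne' (by simp)))) (q + 1)
    refine ⟨⟨⟨i, s + v i, n + J⟩, hgood s i hs⟩, rfl, ?_, ?_, hi0, p, hip⟩
    · show q < n + J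
      omega
    · refine (hJ n).trans ?_
      calc (D : ℝ≥0∞) * w n ≤ (D + 1) * (2⁻¹ ^ (k + 1) / (D + 1)) := by
            gcongr
            exact le_self_add
        _ ≤ _ := ENNReal.mul_div_le
  choose g hg using step
  let σ : ℕ → {σ : ι × (ℕ → ℝ≥0∞) × ℕ // good σ.2.1} := fun n =>
    Nat.rec ⟨⟨i₀, 0, 0⟩, 0, 0, fun q => by simp⟩ (fun k τ => g k τ) n
  have hσ : ∀ k, σ (k + 1) = g k (σ k) := fun k => rfl
  let u : ℕ → ι := fun k => (σ (k + 1)).1.1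
  let t : ℕ → ℕ := fun k => (σ k).1.2.2
  have ht : StrictMono t := strictMono_nat_of_lt_succ fun k => (hg k (σ k)).2.1
  have hsum : ∀ k, (σ k).1.2.1 = fun q => ∑ j ∈ Finset.range k, v (u j) q := by
    intro k
    induction k with
    | zero => ext q; simp [σ]
    | succ k ih =>
      ext q
      rw [hσ, (hg k (σ k)).1, ih, Finset.sum_range_succ]
      rfl
  have hsmall : ∀ k, ∑ j ∈ Finset.range k, v (u j) (t k) ≤ 2⁻¹ ^ k := by
    intro k
    cases k with
    | zero => simp
    | succ k =>
      have h := (hg k (σ k)).2.2.1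
      rw [← hσ] at h
      exact (congrFun (hsum (k + 1)) _).symm.trans_le h
  have hu0 : ∀ k, v (u k) 0 ≤ 2⁻¹ ^ (k + 1) / C ^ t k := fun k => (hg k (σ k)).2.2.2.1
  have hup : ∀ k, ∃ p, 2 ≤ v (u k) p := fun k => (hg k (σ k)).2.2.2.2
  have hgrow : ∀ k q, q ≤ t k → v (u k) q ≤ 2⁻¹ ^ (k + 1) := by
    intro k q hq
    calc v (u k) q ≤ C ^ q * v (u k) 0 := hv _ _
      _ ≤ C ^ t k * (2⁻¹ ^ (k + 1) / C ^ t k) := by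
          gcongr
          exact hu0 k
      _ ≤ _ := ENNReal.mul_div_le
  have hgeom : ∑' k : ℕ, (2⁻¹ : ℝ≥0∞) ^ (k + 1) = 1 := by
    rw [ENNReal.tsum_geometric_add_one, ENNReal.one_sub_inv_two, inv_inv]
    exact ENNReal.inv_mul_cancel two_ne_zero ENNReal.ofNat_ne_top
  refine ⟨u, ?_, ?_, ?_⟩
  · rw [← hgeom]
    exact ENNReal.tsum_le_tsum fun k => hgrow k 0 (Nat.zero_le _)
  · intro N η hη
    have hlim : Tendsto (fun k : ℕ => (2⁻¹ : ℝ≥0∞) ^ k + 2⁻¹ ^ k) atTop (𝓝 0) := by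
      have := ENNReal.tendsto_pow_atTop_nhds_zero_of_lt_one (r := 2⁻¹) (by simp)
      simpa using this.add this
    obtain ⟨k, hk, hkN⟩ := ((hlim.eventually_le_const hη).and (eventually_ge_atTop N)).exists
    refine ⟨t k, hkN.trans ht.le_apply, le_trans ?_ hk⟩
    rw [← ENNReal.summable.sum_add_tsum_nat_add' (k := k)]
    gcongr
    · exact hsmall k
    · calc ∑' j, v (u (j + k)) (t k) ≤ ∑' j, 2⁻¹ ^ k * 2⁻¹ ^ (j + 1) := by
            refine ENNReal.tsum_le_tsum fun j => ?_
            rw [← pow_add, show k + (j + 1) = j + k + 1 by ring]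
            exact hgrow _ _ (ht.monotone (by omega))
        _ = 2⁻¹ ^ k := by rw [ENNReal.tsum_mul_left, hgeom, mul_one]
  · intro N
    obtain ⟨p, hp⟩ := hup N
    refine ⟨p, ?_, N, hp⟩
    by_contra! hlt
    have h1 := hp.trans (hgrow N p (hlt.le.trans ht.le_apply))
    have h2 : (2⁻¹ : ℝ≥0∞) ^ (N + 1) ≤ 1 := pow_le_one' (by simp) _
    exact absurd (h1.trans h2) (by norm_num)

/-- A Young function is sublinear under contractions of the argument. -/
theorem IsYoungFunction.map_mul_le {Φ : ℝ → ℝ≥0∞} (hΦ : IsYoungFunction Φ) (a : ℝ≥0)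
    (ha : a ≤ 1) (x : ℝ) : Φ (a * x) ≤ a * Φ x := by
  simpa [hΦ.map_zero] using hΦ.convex x 0 a (1 - a) (add_tsub_cancel_of_le ha)

theorem IsYoungFunction.map_abs {Φ : ℝ → ℝ≥0∞} (hΦ : IsYoungFunction Φ) (x : ℝ) :
    Φ |x| = Φ x := by
  rcases abs_choice x with h | h <;> rw [h]
  exact hΦ.even x

theorem IsYoungFunction.mono_abs {Φ : ℝ → ℝ≥0∞} (hΦ : IsYoungFunction Φ) {x y : ℝ}
    (h : |x| ≤ |y|) : Φ x ≤ Φ y := by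
  rw [← hΦ.map_abs x, ← hΦ.map_abs y]
  rcases (abs_nonneg y).eq_or_lt with hy | hy
  · rw [← hy] at h ⊢
    rw [le_antisymm h (abs_nonneg x)]
  · have hle : |x| / |y| ≤ 1 := div_le_one_of_le₀ h hy.le
    have key := hΦ.map_mul_le ⟨|x| / |y|, by positivity⟩ hle |y|
    have e : |x| / |y| * |y| = |x| := div_mul_cancel₀ _ hy.ne'
    refine (congrArg Φ e).symm.trans_le (key.trans ?_)
    refine (mul_le_of_le_one_left' ?_)
    exact ENNReal.coe_le_one_iff.2 hle

theorem IsYoungFunction.two_mul_le {Φ : ℝ → ℝ≥0∞} (hΦ : IsYoungFunction Φ) (x : ℝ) :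
    2 * Φ x ≤ Φ (2 * x) := by
  have h := hΦ.map_mul_le 2⁻¹ (by norm_num) (2 * x)
  have e : ((2⁻¹ : ℝ≥0) : ℝ) * (2 * x) = x := by push_cast; ring
  rw [e] at h
  calc 2 * Φ x ≤ 2 * (((2⁻¹ : ℝ≥0) : ℝ≥0∞) * Φ (2 * x)) := by gcongr
    _ = Φ (2 * x) := by
      rw [← mul_assoc, ENNReal.coe_inv (by norm_num)]
      simp [ENNReal.mul_inv_cancel]

/-- Under the global Δ₂-condition, dilations act boundedly on a Young function. -/
theorem IsYoungFunction.exists_map_mul_le {Φ : ℝ → ℝ≥0∞} (hΦ : IsYoungFunction Φ)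
    (hΔ : Delta2Global Φ) (t : ℝ) : ∃ K : ℝ≥0, ∀ x, Φ (t * x) ≤ K * Φ x := by
  obtain ⟨K, -, hK⟩ := hΔ
  have hpow : ∀ (j : ℕ) (x : ℝ), Φ (2 ^ j * x) ≤ (K : ℝ≥0∞) ^ j * Φ x := by
    intro j x
    induction j with
    | zero => simp
    | succ j ih =>
      rw [← hΦ.map_abs, pow_succ', mul_assoc, abs_mul, abs_two]
      refine (hK _ (abs_nonneg _)).trans ?_
      rw [hΦ.map_abs, pow_succ', mul_assoc]
      gcongr
  obtain ⟨j, hj⟩ := pow_unbounded_of_one_lt |t| (one_lt_two (α := ℝ))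
  refine ⟨K ^ j, fun x => ?_⟩
  rw [ENNReal.coe_pow]
  refine (hΦ.mono_abs ?_).trans (hpow j x)
  rw [abs_mul, abs_mul, abs_of_pos (pow_pos (zero_lt_two' ℝ) j)]
  gcongr

theorem le_of_lt_youngInv {Φ : ℝ → ℝ≥0∞} {y : ℝ≥0∞} {x : ℝ} (hx : 0 ≤ x)
    (h : ENNReal.ofReal x < youngInv Φ y) : Φ x ≤ y := by
  by_contra! hlt
  exact absurd h (not_lt.2 (iInf_le_of_le x (iInf_le_of_le hx (iInf_le _ hlt))))

theorem IsYoungFunction.lt_of_youngInv_lt {Φ : ℝ → ℝ≥0∞} (hΦ : IsYoungFunction Φ) {y : ℝ≥0∞}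
    {x : ℝ} (h : youngInv Φ y < ENNReal.ofReal x) : y < Φ x := by
  simp only [youngInv, iInf_lt_iff] at h
  obtain ⟨z, hz, hyz, hzx⟩ := h
  have hzx' := (ENNReal.ofReal_lt_ofReal_iff').1 hzx
  refine hyz.trans_le (hΦ.mono_abs ?_)
  rw [abs_of_nonneg hz, abs_of_pos hzx'.2]
  exact hzx'.1.le

/-- If the modulars `∑ Φ (c k) μ (B k)` are finite, the functions `c k · 1_{B k}` have a common
measurable upper envelope whose modular is controlled by that sum. -/
theorem IsYoungFunction.exists_envelope {X : Type*} [MeasurableSpace X] {μ : Measure X}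
    {Φ : ℝ → ℝ≥0∞} (hΦ : IsYoungFunction Φ) {c : ℕ → ℝ} (hc : ∀ k, 0 < c k) {B : ℕ → Set X}
    (hB : ∀ k, MeasurableSet (B k)) (hsum : ∑' k, Φ (c k) * μ (B k) ≠ ⊤) :
    ∃ f : X → ℝ, Measurable f ∧
      (∀ x, Φ (f x / 2) ≤ ∑' k, (B k).indicator (fun _ => Φ (c k)) x) ∧
      ∀ᵐ x ∂μ, ∀ k, x ∈ B k → c k ≤ f x := by
  let g : X → ℝ≥0∞ := fun x => ⨆ k, (B k).indicator (fun _ => ENNReal.ofReal (c k)) x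
  have hg : Measurable g := Measurable.iSup fun k => measurable_const.indicator (hB k)
  refine ⟨fun x => (g x).toReal, hg.ennreal_toReal, fun x => ?_, ?_⟩
  · rcases eq_or_ne (g x) 0 with h0 | h0
    · simp [h0, hΦ.map_zero]
    rcases eq_or_ne (g x) ⊤ with h1 | h1
    · simp [h1, hΦ.map_zero]
    obtain ⟨k, hk⟩ := lt_iSup_iff.1 (ENNReal.half_lt_self h0 h1)
    have hxk : x ∈ B k := by
      by_contra hx
      simp [hx] at hk
    refine le_trans ?_ (ENNReal.le_tsum k)
    rw [indicator_of_mem hxk] at hk ⊢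
    apply hΦ.mono_abs
    rw [abs_of_nonneg (by positivity), abs_of_pos (hc k)]
    have := ENNReal.toReal_mono ENNReal.ofReal_ne_top hk.le
    rwa [ENNReal.toReal_div, ENNReal.toReal_ofReal (hc k).le] at this
  · have hfin : ∫⁻ x, ∑' k, (B k).indicator (fun _ => Φ (c k)) x ∂μ ≠ ⊤ := by
      rw [lintegral_tsum fun k => (measurable_const.indicator (hB k)).aemeasurable]
      simpa [lintegral_indicator, hB] using hsum
    have hmeas : Measurable fun x => ∑' k, (B k).indicator (fun _ => Φ (c k)) x :=
      Measurable.tsum fun k => measurable_const.indicator (hB k)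
    filter_upwards [ae_lt_top hmeas hfin] with x hx k hxk
    obtain ⟨R, hR, hRpos⟩ := ((hΦ.tendsto_atTop.eventually (lt_mem_nhds hx)).and
      (eventually_gt_atTop 0)).exists
    have hbdd : g x ≤ ENNReal.ofReal R := by
      refine iSup_le fun j => ?_
      by_cases hxj : x ∈ B j
      · rw [indicator_of_mem hxj]
        apply ENNReal.ofReal_le_ofReal
        by_contra! hlt
        have h1 : Φ R ≤ Φ (c j) := hΦ.mono_abs (by
          rw [abs_of_pos hRpos, abs_of_pos (hc j)]; exact hlt.le)
        have h2 := ENNReal.le_tsum (f := fun k => (B k).indicator (fun _ => Φ (c k)) x) j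
        simp only [indicator_of_mem hxj] at h2
        exact absurd (h1.trans h2) (not_le.2 hR)
      · simp [hxj]
    have hle : ENNReal.ofReal (c k) ≤ g x := by
      have := le_iSup (fun k => (B k).indicator (fun _ => ENNReal.ofReal (c k)) x) k
      simpa [hxk] using this
    have := ENNReal.toReal_mono (ne_top_of_le_ne_top ENNReal.ofReal_ne_top hbdd) hle
    rwa [ENNReal.toReal_ofReal (hc k).le] at this

theorem luxNorm_le {X : Type*} [MeasurableSpace X] {Φ : ℝ → ℝ≥0∞} {μ : Measure X} {f : X → ℝ}
    {k : ℝ} (hk : 0 < k) (h : ∫⁻ x, Φ (f x / k) ∂μ ≤ 1) : luxNorm Φ μ f ≤ ENNReal.ofReal k :=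
  iInf_le_of_le k (iInf_le_of_le hk (iInf_le _ h))

theorem IsYoungFunction.le_luxNorm {X : Type*} [MeasurableSpace X] {Φ : ℝ → ℝ≥0∞}
    (hΦ : IsYoungFunction Φ) {μ : Measure X} {f : X → ℝ} {k : ℝ}
    (h : 1 < ∫⁻ x, Φ (f x / k) ∂μ) : ENNReal.ofReal k ≤ luxNorm Φ μ f := by
  refine le_iInf fun l => le_iInf fun hl => le_iInf fun hl1 => ENNReal.ofReal_le_ofReal ?_
  by_contra! hlt
  refine absurd (h.trans_le (lintegral_mono fun x => hΦ.mono_abs ?_)) (not_lt.2 hl1)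
  rw [abs_div, abs_div, abs_of_pos hl, abs_of_pos (hl.trans hlt)]
  gcongr

/-- If the modulars along the orbit of `f` are arbitrarily small and greater than `1` infinitely
often, then the line spanned by `f` is a Li-Yorke scrambled set. -/
theorem IsYoungFunction.compLiYorkeChaotic_of_modular {X : Type*} [MeasurableSpace X]
    {Φ : ℝ → ℝ≥0∞} (hΦ : IsYoungFunction Φ) (hΔ : Delta2Global Φ) {μ : Measure X} {φ : X → X}
    (hφ : Measure.QuasiMeasurePreserving φ μ μ) {f : X → ℝ} (hf : Measurable f)
    (hfin : ∫⁻ x, Φ (f x) ∂μ < ⊤)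
    (hsmall : ∀ (N : ℕ) (η : ℝ≥0∞), 0 < η → ∃ q ≥ N, ∫⁻ x, Φ (f (φ^[q] x)) ∂μ ≤ η)
    (hlarge : ∀ N : ℕ, ∃ p ≥ N, 1 < ∫⁻ x, Φ (f (φ^[p] x)) ∂μ) :
    CompLiYorkeChaotic Φ μ φ := by
  have hdil : ∀ t : ℝ, ∃ K : ℝ≥0, ∀ h : X → ℝ,
      ∫⁻ x, Φ (t * h x) ∂μ ≤ K * ∫⁻ x, Φ (h x) ∂μ := by
    intro t
    obtain ⟨K, hK⟩ := hΦ.exists_map_mul_le hΔ t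
    refine ⟨K, fun h => ?_⟩
    rw [← lintegral_const_mul' _ _ ENNReal.coe_ne_top]
    exact lintegral_mono fun x => hK _
  have hne : ∀ r s : ℝ, r ≠ s → ¬ (fun x => r * f x) =ᵐ[μ] fun x => s * f x := by
    intro r s hrs hae
    have hf0 : ∀ᵐ x ∂μ, f x = 0 := by
      filter_upwards [hae] with x hx
      have : (r - s) * f x = 0 := by rw [sub_mul, hx, sub_self]
      exact (mul_eq_zero.1 this).resolve_left (sub_ne_zero.2 hrs)
    obtain ⟨p, -, hp⟩ := hlarge 0
    have hz : ∫⁻ x, Φ (f (φ^[p] x)) ∂μ = 0 := by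
      rw [lintegral_congr_ae (g := fun _ => 0), lintegral_zero]
      filter_upwards [(hφ.iterate p).ae hf0] with x hx
      rw [hx, hΦ.map_zero]
    rw [hz] at hp
    exact absurd hp (by simp)
  refine ⟨range fun (r : ℝ) x => r * f x, ?_, ?_, ?_, ?_⟩
  · intro hcount
    have hinj : Function.Injective fun (r : ℝ) (x : X) => r * f x := by
      intro r s hrs
      by_contra hne'
      exact hne r s hne' (Eventually.of_forall fun x => congrFun hrs x)
    rw [← image_univ] at hcount
    exact Cardinal.not_countable_real (countable_of_injective_of_countable_image
      hinj.injOn hcount)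
  · rintro _ ⟨r, rfl⟩
    refine ⟨hf.const_mul r, 1, one_pos, ?_⟩
    obtain ⟨K, hK⟩ := hdil r
    simp only [one_mul]
    exact (hK f).trans_lt (ENNReal.mul_lt_top ENNReal.coe_lt_top hfin)
  · rintro _ ⟨r, rfl⟩ _ ⟨s, rfl⟩ h
    exact hne r s fun hrs => h (by rw [hrs])
  · rintro _ ⟨r, rfl⟩ _ ⟨s, rfl⟩ h
    have hrs : r - s ≠ 0 := sub_ne_zero.2 fun hrs => h (by rw [hrs])
    have hfun : ∀ n, ((fun x => r * f x) - fun x => s * f x) ∘ φ^[n] =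
        fun x => (r - s) * f (φ^[n] x) := by
      intro n
      ext x
      simp [sub_mul]
    simp only [hfun]
    constructor
    · refine le_antisymm (le_of_forall_gt fun ε hε => ?_) zero_le
      obtain ⟨δ, hδ0, hδε⟩ := ENNReal.lt_iff_exists_nnreal_btwn.1 hε
      have hδ : 0 < (δ : ℝ) := by exact_mod_cast hδ0
      obtain ⟨K, hK⟩ := hdil ((r - s) / δ)
      refine lt_of_le_of_lt (liminf_le_of_frequently_le' (x := (δ : ℝ≥0∞)) ?_) hδε
      rw [frequently_atTop]
      intro N
      obtain ⟨q, hq, hqη⟩ := hsmall N (1 / (K + 1)) (ENNReal.div_pos one_ne_zero (by simp))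
      refine ⟨q, hq, ?_⟩
      rw [← ENNReal.ofReal_coe_nnreal]
      refine luxNorm_le hδ ?_
      calc ∫⁻ x, Φ ((r - s) * f (φ^[q] x) / δ) ∂μ
          = ∫⁻ x, Φ ((r - s) / δ * f (φ^[q] x)) ∂μ := by
            simp only [div_mul_eq_mul_div]
        _ ≤ K * ∫⁻ x, Φ (f (φ^[q] x)) ∂μ := hK _
        _ ≤ (K + 1) * (1 / (K + 1)) := by
            gcongr
            exact le_self_add
        _ ≤ 1 := ENNReal.mul_div_le
    · refine lt_of_lt_of_le (ENNReal.ofReal_pos.2 (abs_pos.2 hrs))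
        (le_limsup_of_frequently_le' (x := ENNReal.ofReal |r - s|) ?_)
      rw [frequently_atTop]
      intro N
      obtain ⟨p, hp, hp1⟩ := hlarge N
      refine ⟨p, hp, hΦ.le_luxNorm (hp1.trans_le (lintegral_mono fun x => hΦ.mono_abs ?_))⟩
      rw [abs_div, abs_mul, abs_abs, mul_div_cancel_left₀ _ (abs_pos.2 hrs).ne']

theorem measurableSet_iterImage {X : Type*} [MeasurableSpace X] {φ : X → X} (hφ : Measurable φ)
    (himg : ∀ F : Set X, MeasurableSet F → MeasurableSet (φ '' F)) {F : Set X}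
    (hF : MeasurableSet F) (n : ℤ) : MeasurableSet (iterImage φ F n) := by
  unfold iterImage
  split_ifs
  · induction n.toNat with
    | zero => simpa using hF
    | succ k ih =>
      rw [Function.iterate_succ', image_comp]
      exact himg _ ih
  · exact hφ.iterate _ hF

theorem iterImage_neg {X : Type*} (φ : X → X) (F : Set X) (n : ℕ) :
    iterImage φ F (-n) = φ^[n] ⁻¹' F := by
  unfold iterImage
  split_ifs with h
  · have : n = 0 := by omega
    simp [this]
  · simp

theorem preimage_iterImage {X : Type*} {φ : X → X} (hinj : Function.Injective φ) (F : Set X)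
    (n : ℤ) (q : ℕ) : φ^[q] ⁻¹' iterImage φ F n = iterImage φ F (n - q) := by
  have hinj' : ∀ k, Function.Injective φ^[k] := fun k => hinj.iterate k
  by_cases hn : 0 ≤ n
  · lift n to ℕ using hn
    rcases le_total q n with h | h
    · obtain ⟨k, rfl⟩ := Nat.exists_eq_add_of_le h
      have e : ((q + k : ℕ) : ℤ) - q = k := by push_cast; ring
      rw [e]
      simp only [iterImage, Int.natCast_nonneg, if_true, Int.toNat_natCast]
      rw [Function.iterate_add, image_comp, preimage_image_eq _ (hinj' q)]
    · obtain ⟨k, rfl⟩ := Nat.exists_eq_add_of_le h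
      have e : (n : ℤ) - (n + k : ℕ) = -k := by push_cast; ring
      rw [e, iterImage_neg]
      simp only [iterImage, Int.natCast_nonneg, if_true, Int.toNat_natCast]
      rw [Function.iterate_add, preimage_comp, preimage_image_eq _ (hinj' n)]
  · obtain ⟨k, rfl⟩ : ∃ k : ℕ, n = -k := ⟨n.natAbs, by omega⟩
    have e : -(k : ℤ) - q = -((k + q : ℕ) : ℤ) := by push_cast; ring
    rw [e, iterImage_neg, iterImage_neg, Function.iterate_add, preimage_comp]

theorem measure_iterate_preimage_le {X : Type*} [MeasurableSpace X] {μ : Measure X} {φ : X → X}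
    (hφ : Measurable φ) {C : ℝ≥0∞}
    (hC : ∀ F : Set X, MeasurableSet F → μ (φ ⁻¹' F) ≤ C * μ F) {F : Set X}
    (hF : MeasurableSet F) (q : ℕ) : μ (φ^[q] ⁻¹' F) ≤ C ^ q * μ F := by
  induction q with
  | zero => simp
  | succ q ih =>
    rw [Function.iterate_succ, preimage_comp, pow_succ', mul_assoc]
    exact (hC _ (hφ.iterate q hF)).trans (by gcongr)

/-- Corollary for injective `φ`: if there is a measurable set `F` with `0 < μ F < ∞` such that
`limsup_n Φ⁻¹(1/μ(φ^{-n}(F))) = ∞` and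
`sup { Φ⁻¹(1/μ(φ^m(F))) / Φ⁻¹(1/μ(φ^n(F))) : n, m ∈ I, n < m } = ∞`,
where `I = {n ∈ ℤ : 0 < μ(φ^n(F)) < ∞}`, then `C_φ` is Li-Yorke chaotic on `L^Φ(μ)`. -/
theorem compLiYorkeChaotic_of_injective
    {X : Type*} [MeasurableSpace X] (μ : Measure X) [SigmaFinite μ]
    (Φ : ℝ → ℝ≥0∞) (hΦ : IsNFunction Φ) (hΔ : Delta2Global Φ)
    (φ : X → X) (hφ : Measurable φ) (hinj : Function.Injective φ)
    (himg : ∀ F : Set X, MeasurableSet F → MeasurableSet (φ '' F))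
    (c : ℝ≥0) (hc : 0 < c)
    (hbound : ∀ F : Set X, MeasurableSet F → μ (φ ⁻¹' F) ≤ (c : ℝ≥0∞) * μ F)
    (F : Set X) (hF : MeasurableSet F) (hF0 : 0 < μ F) (hF1 : μ F < ⊤)
    (hi : atTop.limsup (fun n : ℕ => youngInv Φ (1 / μ (φ^[n] ⁻¹' F))) = ⊤)
    (hii : (⨆ (n : ℤ) (m : ℤ)
        (_ : 0 < μ (iterImage φ F n) ∧ μ (iterImage φ F n) < ⊤)
        (_ : 0 < μ (iterImage φ F m) ∧ μ (iterImage φ F m) < ⊤)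
        (_ : n < m),
        youngInv Φ (1 / μ (iterImage φ F m)) / youngInv Φ (1 / μ (iterImage φ F n))) = ⊤) :
    CompLiYorkeChaotic Φ μ φ := by
  have hY := hΦ.toIsYoungFunction
  let A : ℤ → Set X := iterImage φ F
  have hA : ∀ n, MeasurableSet (A n) := measurableSet_iterImage hφ himg hF
  let C : ℝ≥0 := max c 1
  have hC : ∀ G : Set X, MeasurableSet G → μ (φ ⁻¹' G) ≤ (C : ℝ≥0∞) * μ G := by
    intro G hG
    refine (hbound G hG).trans ?_
    gcongr
    exact le_max_left _ _
  have hpre : ∀ n (q : ℕ), φ^[q] ⁻¹' A n = A (n - q) := preimage_iterImage hinj F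
  have hstep : ∀ n (q : ℕ), μ (A (n - q)) ≤ (C : ℝ≥0∞) ^ q * μ (A n) := by
    intro n q
    rw [← hpre]
    exact measure_iterate_preimage_le hφ hC (hA n) q
  have hqmp : Measure.QuasiMeasurePreserving φ μ μ := by
    refine ⟨hφ, Measure.AbsolutelyContinuous.mk fun G hG hG0 => ?_⟩
    rw [Measure.map_apply hφ hG]
    simpa [hG0] using hbound G hG
  let ι := {i : ℝ × ℤ // 0 < i.1}
  let v : ι → ℕ → ℝ≥0∞ := fun i q => Φ i.1.1 * μ (A (i.1.2 - q))
  have hgrow : ∀ i q, v i q ≤ (C : ℝ≥0∞) ^ q * v i 0 := by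
    intro i q
    simp only [v]
    calc Φ i.1.1 * μ (A (i.1.2 - q)) ≤ Φ i.1.1 * (C ^ q * μ (A i.1.2)) := by
          gcongr
          exact hstep _ _
      _ = _ := by simp only [Nat.cast_zero, sub_zero]; ring
  have hliminf : ∀ η : ℝ≥0∞, 0 < η → ∃ᶠ n : ℕ in atTop, μ (A (-n)) ≤ η := by
    intro η hη
    obtain ⟨R, hR, hR0⟩ := ((hY.tendsto_atTop.eventually
      (lt_mem_nhds (ENNReal.div_lt_top ENNReal.one_ne_top hη.ne'))).and (eventually_ge_atTop 0)).exists
    have hlt : ENNReal.ofReal R < limsup (fun n : ℕ => youngInv Φ (1 / μ (φ^[n] ⁻¹' F))) atTop := by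
      rw [hi]
      exact ENNReal.ofReal_lt_top
    refine (frequently_lt_of_lt_limsup (by isBoundedDefault) hlt).mono fun n hn => ?_
    have h := hR.le.trans (le_of_lt_youngInv hR0 hn)
    simp only [one_div] at h
    simp only [A, iterImage_neg]
    exact ENNReal.inv_le_inv.1 h
  have hdecay : ∀ n q : ℕ, μ (A (-(n + q : ℕ))) ≤ (C : ℝ≥0∞) ^ q * μ (A (-n)) := by
    intro n q
    have h := hstep (-n) q
    rwa [show -(n : ℤ) - q = -((n + q : ℕ) : ℤ) by push_cast; ring] at h
  have hdom : ∀ i, ∃ J : ℕ, ∃ D : ℝ≥0, ∀ q : ℕ, v i (q + J) ≤ D * μ (A (-q)) := by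
    intro i
    refine ⟨i.1.2.toNat, (Φ i.1.1).toNNReal * C ^ (i.1.2.toNat - i.1.2).toNat, fun q => ?_⟩
    have h := hstep (-q) (i.1.2.toNat - i.1.2).toNat
    have e : -(q : ℤ) - ((i.1.2.toNat - i.1.2).toNat : ℕ) = i.1.2 - ((q + i.1.2.toNat : ℕ) : ℤ) := by
      omega
    rw [e] at h
    simp only [v]
    rw [ENNReal.coe_mul, ENNReal.coe_toNNReal (hΦ.lt_top _).ne, ENNReal.coe_pow, mul_assoc]
    gcongr
  have hbig : ∀ ε : ℝ≥0∞, 0 < ε → ∃ i p, v i 0 ≤ ε ∧ 2 ≤ v i p := by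
    intro ε hε
    obtain ⟨δ, hδ0, hδε⟩ := ENNReal.lt_iff_exists_nnreal_btwn.1 (lt_min hε one_pos)
    have hδpos : 0 < δ := by exact_mod_cast hδ0
    have hδ1 : δ ≤ 1 := by exact_mod_cast (hδε.trans_le (min_le_right _ _)).le
    have hlt : ((2 / δ : ℝ≥0) : ℝ≥0∞) < ⊤ := ENNReal.coe_lt_top
    rw [← hii] at hlt
    simp only [lt_iSup_iff] at hlt
    obtain ⟨n, m, hn, hm, hnm, hlt⟩ := hlt
    have hR0 : ((2 / δ : ℝ≥0) : ℝ≥0∞) ≠ 0 := by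
      exact_mod_cast (div_pos two_pos hδpos).ne'
    have hlt' := ENNReal.mul_lt_of_lt_div hlt
    rw [mul_comm, ← ENNReal.lt_div_iff_mul_lt (Or.inl hR0) (Or.inl ENNReal.coe_ne_top)] at hlt'
    obtain ⟨x, hnx, hxm⟩ := ENNReal.lt_iff_exists_nnreal_btwn.1 hlt'
    have hx0 : 0 < (x : ℝ) :=
      NNReal.coe_pos.2 (ENNReal.coe_pos.1 (pos_of_gt hnx))
    have h1 : 1 / μ (A n) < Φ x := hY.lt_of_youngInv_lt (by simpa using hnx)
    rw [ENNReal.lt_div_iff_mul_lt (Or.inl hR0) (Or.inl ENNReal.coe_ne_top)] at hxm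
    have h2 : Φ (((2 / δ * x : ℝ≥0)) : ℝ) ≤ 1 / μ (A m) := by
      refine le_of_lt_youngInv (NNReal.coe_nonneg _) ?_
      rw [ENNReal.ofReal_coe_nnreal, mul_comm, ENNReal.coe_mul]
      exact hxm
    refine ⟨⟨⟨2 * x, m⟩, by positivity⟩, (m - n).toNat, ?_, ?_⟩
    · have e : (2 * x : ℝ) = δ * ((2 / δ * x : ℝ≥0) : ℝ) := by
        have : (δ : ℝ) ≠ 0 := by exact_mod_cast hδpos.ne'
        push_cast
        field_simp
      simp only [v, Nat.cast_zero, sub_zero]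
      rw [e]
      calc _ ≤ (δ : ℝ≥0∞) * (1 / μ (A m)) * μ (A m) := by
            gcongr
            refine (hY.map_mul_le δ hδ1 _).trans ?_
            gcongr
        _ = δ := by
            rw [mul_assoc, ENNReal.div_mul_cancel hm.1.ne' hm.2.ne, mul_one]
        _ ≤ ε := hδε.le.trans (min_le_left _ _)
    · have e : m - ((m - n).toNat : ℤ) = n := by omega
      simp only [v]
      rw [e]
      calc (2 : ℝ≥0∞) = 2 * (1 / μ (A n) * μ (A n)) := by
            rw [ENNReal.div_mul_cancel hn.1.ne' hn.2.ne, mul_one]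
        _ ≤ 2 * (Φ x * μ (A n)) := by gcongr
        _ = 2 * Φ x * μ (A n) := by ring
        _ ≤ Φ (2 * x) * μ (A n) := by
            gcongr
            exact hY.two_mul_le x
  obtain ⟨u, hu0, husmall, hularge⟩ := exists_seq_small_sum_of_unbounded_growth v
    (fun q => μ (A (-q))) C (le_max_right _ _) hgrow hliminf hdecay hdom hbig
  let a : ℕ → ℝ := fun k => (u k).1.1
  let B : ℕ → Set X := fun k => A (u k).1.2
  have hB : ∀ k, MeasurableSet (B k) := fun k => hA _
  have hv : ∀ k q, v (u k) q = Φ (a k) * μ (φ^[q] ⁻¹' B k) := by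
    intro k q
    rw [hpre]
  obtain ⟨f, hf, hfle, hfge⟩ := hY.exists_envelope (μ := μ) (c := a) (fun k => (u k).2) hB (by
    have h := ne_top_of_le_ne_top ENNReal.one_ne_top hu0
    simpa only [hv, Function.iterate_zero, preimage_id] using h)
  obtain ⟨K, hK⟩ := hY.exists_map_mul_le hΔ 2
  have hupper : ∀ q, ∫⁻ x, Φ (f (φ^[q] x)) ∂μ ≤ K * ∑' k, v (u k) q := by
    intro q
    calc ∫⁻ x, Φ (f (φ^[q] x)) ∂μ
        ≤ ∫⁻ x, K * ∑' k, (φ^[q] ⁻¹' B k).indicator (fun _ => Φ (a k)) x ∂μ := by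
          refine lintegral_mono fun x => ?_
          have h := hK (f (φ^[q] x) / 2)
          rw [mul_div_cancel₀ _ (two_ne_zero' ℝ)] at h
          refine h.trans ?_
          gcongr
          exact hfle _
      _ = K * ∑' k, v (u k) q := by
          have hm : ∀ k, MeasurableSet (φ^[q] ⁻¹' B k) := fun k => hφ.iterate q (hB k)
          rw [lintegral_const_mul' _ _ ENNReal.coe_ne_top,
            lintegral_tsum fun k => (measurable_const.indicator (hm k)).aemeasurable]
          simp only [hv, lintegral_indicator_const (hm _)]
  have hlower : ∀ k p, v (u k) p ≤ ∫⁻ x, Φ (f (φ^[p] x)) ∂μ := by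
    intro k p
    rw [hv, ← lintegral_indicator_const (hφ.iterate p (hB k))]
    refine lintegral_mono_ae ?_
    filter_upwards [(hqmp.iterate p).ae hfge] with x hx
    by_cases hxk : x ∈ φ^[p] ⁻¹' B k
    · rw [indicator_of_mem hxk]
      exact hY.mono_abs (abs_le_abs_of_nonneg (u k).2.le (hx k hxk))
    · simp [hxk]
  refine hY.compLiYorkeChaotic_of_modular hΔ hqmp hf ?_ ?_ ?_
  · exact (hupper 0).trans_lt (ENNReal.mul_lt_top ENNReal.coe_lt_top
      (hu0.trans_lt ENNReal.one_lt_top))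
  · intro N η hη
    obtain ⟨q, hq, hqη⟩ := husmall N (η / (K + 1)) (ENNReal.div_pos hη.ne' (by simp))
    refine ⟨q, hq, (hupper q).trans ?_⟩
    calc (K : ℝ≥0∞) * ∑' k, v (u k) q ≤ (K + 1) * (η / (K + 1)) := by
          gcongr
          exact le_self_add
      _ ≤ η := ENNReal.mul_div_le
  · intro N
    obtain ⟨p, hp, k, hk⟩ := hularge N
    exact ⟨p, hp, lt_of_lt_of_le (by norm_num) (hk.trans (hlower k p))⟩
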